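/- The Σ-induced multi-rb culpability measure m^Σ_{C_#} induced by the counting culpability measure C_# satisfies Multiset Monotony (MO): for every multiset of rule bases M and every rule r, V̂^{m^Σ_{C_#}}(M ∪ {r}) ≥ V̂^{m^Σ_{C_#}}(M). -/

import Mathlib

open scoped Classical

/-- A literal over a set of atoms `A`: an atom or its negation. -/
inductive Literal (A : Type) where
  | pos (a : A)
  | neg (a : A)
deriving DecidableEq

/-- A business rule `l₁,...,lₘ → l₀`: a finite body of literals and a head literal.
A rule with empty body is a fact. -/
structure Rule (A : Type) where
  body : Finset (Literal A)
  head : Literal A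

instance {A : Type} [DecidableEq A] : DecidableEq (Rule A) :=
  fun r s => decidable_of_iff (r.body = s.body ∧ r.head = s.head)
    (by cases r; cases s; simp)

/-- A set of literals `M` is closed w.r.t. a rule base `B` if for every rule of `B`
whose body is contained in `M`, its head is in `M`. -/
def LitsClosed {A : Type} (B : Finset (Rule A)) (M : Set (Literal A)) : Prop :=
  ∀ r ∈ B, (∀ l ∈ r.body, l ∈ M) → r.head ∈ M

/-- The minimal model of a rule base: the smallest closed set of literals. -/
def minModel {A : Type} (B : Finset (Rule A)) : Set (Literal A) :=
  ⋂₀ {M : Set (Literal A) | LitsClosed B M}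

/-- A set of literals is consistent if it contains no atom together with its negation. -/
def ConsistentLits {A : Type} (M : Set (Literal A)) : Prop :=
  ∀ a : A, ¬ (Literal.pos a ∈ M ∧ Literal.neg a ∈ M)

/-- A rule base is consistent if its minimal model is consistent. -/
def RBConsistent {A : Type} (B : Finset (Rule A)) : Prop :=
  ConsistentLits (minModel B)

/-- `MI B`: the minimal inconsistent subsets of `B`. -/
noncomputable def MI {A : Type} [DecidableEq A] (B : Finset (Rule A)) :
    Finset (Finset (Rule A)) :=
  B.powerset.filter fun M => ¬ RBConsistent M ∧ ∀ M' ∈ M.powerset, M' ≠ M → RBConsistent M'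

/-- `F(B)`: the facts (rules with empty body) of a rule base. -/
noncomputable def factsOf {A : Type} (B : Finset (Rule A)) : Finset (Rule A) :=
  B.filter fun r => r.body = ∅

/-- `R(B)`: the non-fact rules of a rule base. -/
noncomputable def rulesOf {A : Type} (B : Finset (Rule A)) : Finset (Rule A) :=
  B.filter fun r => r.body ≠ ∅

/-- The Σ-induced multi-rb culpability measure: a multiset of rule bases is given by a shared
rule set `R` and case-dependent fact sets `F i`, so that `Bᵢ = F i ∪ R`;
then `m^Σ_C(M, r) = Σᵢ C(Bᵢ, r)`. -/
noncomputable def mSigma {A : Type} [DecidableEq A] {n : ℕ}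
    (C : Finset (Rule A) → Rule A → ENNReal)
    (R : Finset (Rule A)) (F : Fin n → Finset (Rule A)) (r : Rule A) : ENNReal :=
  ∑ i : Fin n, C (F i ∪ R) r

/-- `V̂^{C^m}(M) = max_{r ∈ R(M)} C^m(M, r)` for the Σ-induced measure. -/
noncomputable def Vhat {A : Type} [DecidableEq A] {n : ℕ}
    (C : Finset (Rule A) → Rule A → ENNReal)
    (R : Finset (Rule A)) (F : Fin n → Finset (Rule A)) : ENNReal :=
  R.sup fun r => mSigma C R F r

/-- The counting culpability measure `C_#`. -/
noncomputable def Ccount {A : Type} [DecidableEq A] (B : Finset (Rule A)) (r : Rule A) : ENNReal :=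
  (((MI B).filter fun M => r ∈ M).card : ENNReal)

theorem MI_mono {A : Type} [DecidableEq A] {B B' : Finset (Rule A)} (h : B ⊆ B') :
    MI B ⊆ MI B' :=
  Finset.filter_subset_filter _ (Finset.powerset_mono.2 h)

theorem Ccount_mono {A : Type} [DecidableEq A] {B B' : Finset (Rule A)} (h : B ⊆ B')
    (r : Rule A) : Ccount B r ≤ Ccount B' r :=
  Nat.cast_le.2 (Finset.card_le_card (Finset.filter_subset_filter _ (MI_mono h)))

theorem mSigma_mono {A : Type} [DecidableEq A] {n : ℕ} {C : Finset (Rule A) → Rule A → ENNReal}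
    (hC : ∀ ⦃B B' : Finset (Rule A)⦄, B ⊆ B' → ∀ r, C B r ≤ C B' r)
    {R R' : Finset (Rule A)} (h : R ⊆ R') (F : Fin n → Finset (Rule A)) (r : Rule A) :
    mSigma C R F r ≤ mSigma C R' F r :=
  Finset.sum_le_sum fun _ _ => hC (Finset.union_subset_union_right h) r

theorem Vhat_mono {A : Type} [DecidableEq A] {n : ℕ} {C : Finset (Rule A) → Rule A → ENNReal}
    (hC : ∀ ⦃B B' : Finset (Rule A)⦄, B ⊆ B' → ∀ r, C B r ≤ C B' r)
    {R R' : Finset (Rule A)} (h : R ⊆ R') (F : Fin n → Finset (Rule A)) :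
    Vhat C R F ≤ Vhat C R' F :=
  (Finset.sup_mono_fun fun r _ => mSigma_mono hC h F r).trans (Finset.sup_mono h)

/-- `m^Σ_{C_#}` satisfies Multiset Monotony (MO). -/
theorem mSigma_Ccount_multiset_monotony {A : Type} [DecidableEq A] (n : ℕ)
    (R : Finset (Rule A)) (F : Fin n → Finset (Rule A))
    (hR : ∀ x ∈ R, x.body ≠ ∅) (hF : ∀ i : Fin n, ∀ x ∈ F i, Rule.body x = ∅)
    (r : Rule A) (hr : r.body ≠ ∅) :
    Vhat Ccount (insert r R) F ≥ Vhat Ccount R F :=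
  Vhat_mono (fun _ _ h => Ccount_mono h) (Finset.subset_insert r R) F
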